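/- arXiv:2310.07703 — 3 statements merged into one kernel-verified Lean document; each statement's English description precedes it below -/
import Mathlib

section
/- Let N ≥ 3 be an integer and let v be a real number with 0 < v < 1. Then ∫₀^{v^{1/N}} N t^N / √((v − t^N)(2 − v + t^N)) dt = √(π/2) · v^{1/2 + 1/N} · (Γ(1/N) / (N·Γ(3/2 + 1/N))) · F(1/2, 1/2; 3/2 + 1/N; v/2). (Note that for 0 < t < v^{1/N} both factors v − t^N and 2 − v + t^N are positive, so the integrand is real and positive.) -/
open MeasureTheory

/-- The Gauss hypergeometric function `F(a,b;c;z)` for real parameters, defined by its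
series `∑ₖ (Γ(a+k)Γ(b+k)Γ(c))/(Γ(a)Γ(b)Γ(c+k)k!) zᵏ`. -/
noncomputable def hyperF (a b c z : ℝ) : ℝ :=
  ∑' k : ℕ, (Real.Gamma (a + k) * Real.Gamma (b + k) * Real.Gamma c) /
    (Real.Gamma a * Real.Gamma b * Real.Gamma (c + k) * (Nat.factorial k)) * z ^ k

/-- The binomial series of `(1 - x) ^ (-a)`, with coefficients written in terms of `Γ`. -/
theorem hasSum_Gamma_one_sub_rpow_neg {a x : ℝ} (ha : 0 < a) (hx : |x| < 1) :
    HasSum (fun k : ℕ => Real.Gamma (a + k) / (Real.Gamma a * k.factorial) * x ^ k)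
      ((1 - x) ^ (-a)) := by
  have hcoeff (k : ℕ) :
      Ring.choose (a + k - 1) k = Real.Gamma (a + k) / (Real.Gamma a * k.factorial) := by
    have hk : (k.factorial : ℝ) ≠ 0 := by positivity
    have hG := (Real.Gamma_pos_of_pos ha).ne'
    have h := Ring.factorial_nsmul_multichoose_eq_ascPochhammer a k
    rw [Polynomial.ascPochhammer_smeval_eq_eval, nsmul_eq_mul, Ring.multichoose_eq] at h
    have hΓ : Real.Gamma (a + k) = (ascPochhammer ℝ k).eval a * Real.Gamma a := by
      clear h hk
      induction k with
      | zero => simp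
      | succ k ih =>
        rw [Nat.cast_succ, ← add_assoc, Real.Gamma_add_one (by positivity), ih,
          ascPochhammer_succ_eval]
        ring
    rw [hΓ, ← h]
    field_simp
  have hsum := (Real.one_div_one_sub_rpow_hasFPowerSeriesOnBall_zero a).hasSum (y := x)
    (by simpa [enorm_eq_nnnorm, ← NNReal.coe_lt_coe] using hx)
  have h0 : 0 ≤ 1 - x := by linarith [(abs_lt.mp hx).2]
  simpa [Real.rpow_neg h0, hcoeff, mul_comm] using hsum

theorem integrableOn_rpow_mul_one_sub_rpow {p q : ℝ} (hp : 0 < p) (hq : 0 < q) :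
    IntegrableOn (fun s : ℝ => s ^ (p - 1) * (1 - s) ^ (q - 1)) (Set.Ioo 0 1) := by
  have h := Complex.betaIntegral_convergent (u := p) (v := q) (by simpa) (by simpa)
  rw [intervalIntegrable_iff_integrableOn_Ioo_of_le zero_le_one] at h
  refine IntegrableOn.congr_fun h.re (fun s hs => ?_) measurableSet_Ioo
  have h1 : 0 ≤ 1 - s := by linarith [hs.2]
  simp only [RCLike.re_to_complex]
  norm_cast
  rw [← Complex.ofReal_cpow hs.1.le, ← Complex.ofReal_cpow h1]
  norm_cast

theorem integral_rpow_mul_one_sub_rpow {p q : ℝ} (hp : 0 < p) (hq : 0 < q) :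
    ∫ s in Set.Ioo (0:ℝ) 1, s ^ (p - 1) * (1 - s) ^ (q - 1) =
      Real.Gamma p * Real.Gamma q / Real.Gamma (p + q) := by
  have h := Complex.betaIntegral_eq_Gamma_mul_div p q (by simpa) (by simpa)
  rw [Complex.betaIntegral, intervalIntegral.integral_of_le zero_le_one,
    integral_Ioc_eq_integral_Ioo] at h
  rw [← Complex.ofReal_inj]
  push_cast [← Complex.Gamma_ofReal]
  rw [← h, ← integral_complex_ofReal]
  refine setIntegral_congr_fun measurableSet_Ioo fun s hs => ?_
  have h1 : 0 ≤ 1 - s := by linarith [hs.2]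
  push_cast [Complex.ofReal_cpow hs.1.le, Complex.ofReal_cpow h1]
  rfl

/-- **Euler's integral representation** of the Gauss hypergeometric function. -/
theorem integral_eq_Gamma_mul_hyperF {a b c z : ℝ} (ha : 0 < a) (hb : 0 < b) (hbc : b < c)
    (hz : |z| < 1) :
    ∫ s in Set.Ioo (0:ℝ) 1, s ^ (b - 1) * (1 - s) ^ (c - b - 1) * (1 - z * s) ^ (-a) =
      Real.Gamma b * Real.Gamma (c - b) / Real.Gamma c * hyperF a b c z := by
  have hq : 0 < c - b := by linarith
  have hΓa := Real.Gamma_pos_of_pos ha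
  set C : ℕ → ℝ := fun k => Real.Gamma (a + k) / (Real.Gamma a * k.factorial) with hC
  have hC0 (k : ℕ) : 0 ≤ C k :=
    div_nonneg (Real.Gamma_pos_of_pos (by positivity)).le (by positivity)
  set w : ℕ → ℝ → ℝ := fun k s => s ^ (b + k - 1) * (1 - s) ^ (c - b - 1) with hw
  have hwint (k : ℕ) : IntegrableOn (w k) (Set.Ioo 0 1) :=
    integrableOn_rpow_mul_one_sub_rpow (by positivity) hq
  have hw0 (k : ℕ) {s : ℝ} (hs : s ∈ Set.Ioo (0:ℝ) 1) : 0 ≤ w k s :=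
    mul_nonneg (Real.rpow_nonneg hs.1.le _) (Real.rpow_nonneg (by linarith [hs.2]) _)
  have hwle (k : ℕ) : ∫ s in Set.Ioo (0:ℝ) 1, w k s ≤ ∫ s in Set.Ioo (0:ℝ) 1, w 0 s := by
    refine setIntegral_mono_on (hwint k) (hwint 0) measurableSet_Ioo fun s hs => ?_
    refine mul_le_mul_of_nonneg_right ?_ (Real.rpow_nonneg (by linarith [hs.2]) _)
    exact Real.rpow_le_rpow_of_exponent_ge hs.1 hs.2.le (by simp)
  have hnorm (k : ℕ) : ∫ s in Set.Ioo (0:ℝ) 1, ‖C k * z ^ k * w k s‖ =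
      C k * |z| ^ k * ∫ s in Set.Ioo (0:ℝ) 1, w k s := by
    rw [← integral_const_mul]
    refine setIntegral_congr_fun measurableSet_Ioo fun s hs => ?_
    simp [abs_of_nonneg (hC0 k), abs_of_nonneg (hw0 k hs)]
  have hsummable : Summable fun k => ∫ s in Set.Ioo (0:ℝ) 1, ‖C k * z ^ k * w k s‖ := by
    refine Summable.of_nonneg_of_le (fun k => integral_nonneg fun s => norm_nonneg _) (fun k => ?_)
      ((hasSum_Gamma_one_sub_rpow_neg ha (x := |z|) (by simpa)).summable.mul_right
        (∫ s in Set.Ioo (0:ℝ) 1, w 0 s))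
    rw [hnorm]
    exact mul_le_mul_of_nonneg_left (hwle k) (mul_nonneg (hC0 k) (by positivity))
  have hmain := hasSum_integral_of_summable_integral_norm
    (fun k => (hwint k).const_mul (C k * z ^ k)) hsummable
  have hlhs : ∫ s in Set.Ioo (0:ℝ) 1, s ^ (b - 1) * (1 - s) ^ (c - b - 1) * (1 - z * s) ^ (-a) =
      ∫ s in Set.Ioo (0:ℝ) 1, ∑' k, C k * z ^ k * w k s := by
    refine setIntegral_congr_fun measurableSet_Ioo fun s hs => ?_
    have hzs : |z * s| < 1 := by
      rw [abs_mul, abs_of_pos hs.1]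
      nlinarith [abs_nonneg z, hs.1, hs.2]
    have h := (hasSum_Gamma_one_sub_rpow_neg ha hzs).mul_left
      (s ^ (b - 1) * (1 - s) ^ (c - b - 1))
    refine (h.tsum_eq.symm.trans (tsum_congr fun k => ?_))
    simp only [hw, hC]
    rw [show b + k - 1 = b - 1 + k by ring, Real.rpow_add_natCast hs.1.ne', mul_pow]
    ring
  rw [hlhs, ← hmain.tsum_eq, hyperF, ← tsum_mul_left]
  refine tsum_congr fun k => ?_
  have hΓb := Real.Gamma_pos_of_pos hb
  have hΓc := Real.Gamma_pos_of_pos (hb.trans hbc)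
  rw [integral_const_mul, hw, integral_rpow_mul_one_sub_rpow (by positivity) hq,
    show b + k + (c - b) = c + k by ring]
  simp only [hC]
  field_simp

/-- The substitution `s = 1 - t ^ N / v`. -/
theorem integral_comp_one_sub_pow_div {N : ℕ} (hN : N ≠ 0) {v : ℝ} (hv : 0 < v) (g : ℝ → ℝ) :
    ∫ s in Set.Ioo (0:ℝ) 1, g s =
      ∫ t in Set.Ioo (0:ℝ) (v ^ ((1:ℝ) / N)), N * t ^ (N - 1) / v * g (1 - t ^ N / v) := by
  have hpow : (v ^ ((1:ℝ) / N)) ^ N = v := by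
    rw [one_div, Real.rpow_inv_natCast_pow hv.le hN]
  have himage : (fun t : ℝ => 1 - t ^ N / v) '' Set.Ioo 0 (v ^ ((1:ℝ) / N)) = Set.Ioo 0 1 := by
    ext s
    constructor
    · rintro ⟨t, ht, rfl⟩
      have h1 : t ^ N < v := by
        rw [← hpow]; exact pow_lt_pow_left₀ ht.2 ht.1.le hN
      have h2 : 0 < t ^ N := pow_pos ht.1 N
      exact ⟨by simpa using (div_lt_one hv).2 h1, by simpa using div_pos h2 hv⟩
    · intro hs
      have h1 : 0 < v * (1 - s) := mul_pos hv (by linarith [hs.2])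
      refine ⟨(v * (1 - s)) ^ ((1:ℝ) / N), ⟨Real.rpow_pos_of_pos h1 _, ?_⟩, ?_⟩
      · exact Real.rpow_lt_rpow h1.le (by nlinarith [hs.1]) (by positivity)
      · simp only [one_div, Real.rpow_inv_natCast_pow h1.le hN]
        field_simp
        ring
  have hderiv : ∀ t ∈ Set.Ioo (0:ℝ) (v ^ ((1:ℝ) / N)),
      HasDerivWithinAt (fun t : ℝ => 1 - t ^ N / v) (-(N * t ^ (N - 1) / v))
        (Set.Ioo 0 (v ^ ((1:ℝ) / N))) t := fun t _ =>
    (((hasDerivAt_pow N t).div_const v).const_sub 1).hasDerivWithinAt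
  have hinj : Set.InjOn (fun t : ℝ => 1 - t ^ N / v) (Set.Ioo 0 (v ^ ((1:ℝ) / N))) := by
    intro x hx y hy hxy
    have : x ^ N = y ^ N := by
      simp only [sub_right_inj] at hxy
      exact (div_left_inj' hv.ne').1 hxy
    exact (pow_left_inj₀ hx.1.le hy.1.le hN).1 this
  rw [← himage, integral_image_eq_integral_abs_deriv_smul measurableSet_Ioo hderiv hinj]
  refine setIntegral_congr_fun measurableSet_Ioo fun t ht => ?_
  have h : 0 ≤ N * t ^ (N - 1) / v :=
    div_nonneg (mul_nonneg N.cast_nonneg (pow_nonneg ht.1.le _)) hv.le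
  simp [abs_of_nonneg h]

/-- For integer `N ≥ 3` and `0 < v < 1`,
`∫₀^{v^{1/N}} N t^N / √((v - t^N)(2 - v + t^N)) dt
  = √(π/2) · v^{1/2+1/N} · Γ(1/N)/(N·Γ(3/2+1/N)) · F(1/2,1/2;3/2+1/N;v/2)`. -/
theorem sw_period_integral_AD (N : ℕ) (hN : 3 ≤ N) (v : ℝ) (hv0 : 0 < v) (hv1 : v < 1) :
    ∫ t in Set.Ioo (0:ℝ) (v ^ ((1:ℝ)/N)),
        N * t ^ N / Real.sqrt ((v - t ^ N) * (2 - v + t ^ N)) =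
      Real.sqrt (Real.pi / 2) * v ^ ((1:ℝ)/2 + 1/N) *
        (Real.Gamma (1/N) / (N * Real.Gamma (3/2 + 1/N))) *
        hyperF (1/2) (1/2) (3/2 + 1/N) (v/2) := by
  have hN0 : N ≠ 0 := by omega
  have hNpos : (0:ℝ) < N := by positivity
  have hpow : (v ^ ((1:ℝ) / N)) ^ N = v := by
    rw [one_div, Real.rpow_inv_natCast_pow hv0.le hN0]
  have heuler := integral_eq_Gamma_mul_hyperF (a := 1/2) (b := 1/2) (c := 3/2 + 1/N) (z := v/2)
    (by norm_num) (by norm_num) (by linarith [one_div_pos.2 hNpos])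
    (by rw [abs_of_pos (by positivity)]; linarith)
  rw [integral_comp_one_sub_pow_div hN0 hv0] at heuler
  have hcongr : ∫ t in Set.Ioo (0:ℝ) (v ^ ((1:ℝ)/N)),
        N * t ^ N / Real.sqrt ((v - t ^ N) * (2 - v + t ^ N)) =
      ∫ t in Set.Ioo (0:ℝ) (v ^ ((1:ℝ)/N)), v ^ ((1:ℝ)/2 + 1/N) / Real.sqrt 2 *
        (N * t ^ (N - 1) / v * ((1 - t ^ N / v) ^ ((1:ℝ)/2 - 1) *
          (1 - (1 - t ^ N / v)) ^ ((3:ℝ)/2 + 1/N - 1/2 - 1) *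
          (1 - v / 2 * (1 - t ^ N / v)) ^ (-((1:ℝ)/2)))) := by
    refine setIntegral_congr_fun measurableSet_Ioo fun t ht => ?_
    have h1 : t ^ N < v := by
      rw [← hpow]; exact pow_lt_pow_left₀ ht.2 ht.1.le hN0
    have h2 : 0 < t ^ N := pow_pos ht.1 N
    have h3 : 0 < v - t ^ N := by linarith
    have h4 : 0 < 2 - v + t ^ N := by linarith
    have e1 : (1 - t ^ N / v) ^ ((1:ℝ)/2 - 1) = √v / √(v - t ^ N) := by
      rw [show (1:ℝ)/2 - 1 = -(1/2) by norm_num, show 1 - t ^ N / v = (v - t ^ N) / v by field_simp,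
        Real.rpow_neg (by positivity), ← Real.sqrt_eq_rpow, Real.sqrt_div h3.le, inv_div]
    have e2 : (1 - (1 - t ^ N / v)) ^ ((3:ℝ)/2 + 1/N - 1/2 - 1) = t / v ^ ((1:ℝ) / N) := by
      rw [sub_sub_cancel, show (3:ℝ)/2 + 1/N - 1/2 - 1 = 1/N by ring,
        Real.div_rpow h2.le hv0.le, one_div, Real.pow_rpow_inv_natCast ht.1.le hN0]
    have e3 : (1 - v / 2 * (1 - t ^ N / v)) ^ (-((1:ℝ)/2)) = √2 / √(2 - v + t ^ N) := by
      rw [show 1 - v / 2 * (1 - t ^ N / v) = (2 - v + t ^ N) / 2 by field_simp; ring,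
        Real.rpow_neg (by positivity), ← Real.sqrt_eq_rpow, Real.sqrt_div h4.le, inv_div]
    have e4 : t ^ N = t ^ (N - 1) * t := (pow_sub_one_mul hN0 t).symm
    have hv : √v * √v = v := Real.mul_self_sqrt hv0.le
    simp only [e1, e2, e3]
    rw [Real.sqrt_mul h3.le, Real.rpow_add hv0, ← Real.sqrt_eq_rpow]
    have p1 : 0 < √(v - t ^ N) := Real.sqrt_pos.2 h3
    have p2 : 0 < √(2 - v + t ^ N) := Real.sqrt_pos.2 h4
    have p3 : 0 < v ^ ((1:ℝ) / N) := Real.rpow_pos_of_pos hv0 _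
    generalize √(v - t ^ N) = A at *
    generalize √(2 - v + t ^ N) = B at *
    generalize v ^ ((1:ℝ) / N) = D at *
    rw [e4]
    have p4 : 0 < √v := Real.sqrt_pos.2 hv0
    have : √v * D / √2 * (N * t ^ (N - 1) / v * (√v / A * (t / D) * (√2 / B))) =
        (√v * √v) / v * (N * (t ^ (N - 1) * t) / (A * B)) := by
      field_simp
    rw [this, hv, div_self hv0.ne', one_mul]
  rw [hcongr, integral_const_mul, heuler, show (3:ℝ)/2 + 1/N - 1/2 = 1/N + 1 by ring,
    Real.Gamma_add_one (by positivity), Real.Gamma_one_half_eq, Real.sqrt_div Real.pi_pos.le]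
  field_simp
end

section
/- For every real number α with 0 < α < 1/4, one has (Γ(1/2)·Γ(1/2 − 2α)/Γ(1/2 − α)²)·(Γ(1/2)·Γ(1/2 + 2α)/Γ(1/2 + α)²) − (Γ(1/2)·Γ(1/2 − 2α)/Γ(1 − α)²)·(Γ(1/2)·Γ(1/2 + 2α)/Γ(α)²) = 1. -/
/-- Euler's reflection formula centred at `1/2`. -/
theorem Real.Gamma_half_sub_mul_Gamma_half_add (x : ℝ) :
    Real.Gamma (1/2 - x) * Real.Gamma (1/2 + x) = Real.pi / Real.cos (Real.pi * x) := by
  have h := Real.Gamma_mul_Gamma_one_sub (1/2 - x)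
  rwa [show 1 - (1/2 - x) = 1/2 + x by ring,
    show Real.pi * (1/2 - x) = Real.pi / 2 - Real.pi * x by ring, Real.sin_pi_div_two_sub] at h


/-- The connection matrix `S` relating the two bases of solutions of the hypergeometric
equation has determinant one: for `0 < α < 1/4`,
`S₁₃·S₂₄ − S₁₄·S₂₃ = 1`. -/
theorem connection_matrix_det_one (α : ℝ) (h0 : 0 < α) (h1 : α < 1/4) :
    (Real.Gamma (1/2) * Real.Gamma (1/2 - 2*α) / (Real.Gamma (1/2 - α))^2) *
      (Real.Gamma (1/2) * Real.Gamma (1/2 + 2*α) / (Real.Gamma (1/2 + α))^2) -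
    (Real.Gamma (1/2) * Real.Gamma (1/2 - 2*α) / (Real.Gamma (1 - α))^2) *
      (Real.Gamma (1/2) * Real.Gamma (1/2 + 2*α) / (Real.Gamma α)^2) = 1 := by
  have half_sq : Real.Gamma (1/2) ^ 2 = Real.pi := by
    rw [Real.Gamma_one_half_eq, Real.sq_sqrt Real.pi_pos.le]
  have hcos : 0 < Real.cos (Real.pi * (2*α)) :=
    Real.cos_pos_of_mem_Ioo ⟨by nlinarith [Real.pi_pos], by nlinarith [Real.pi_pos]⟩
  have cos_double : Real.cos (Real.pi * (2*α)) =
      Real.cos (Real.pi * α) ^ 2 - Real.sin (Real.pi * α) ^ 2 := by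
    rw [← Real.cos_two_mul']
    ring_nf
  calc
    _ = (Real.Gamma (1/2) ^ 2) * (Real.Gamma (1/2 - 2*α) * Real.Gamma (1/2 + 2*α)) *
        (1 / (Real.Gamma (1/2 - α) * Real.Gamma (1/2 + α)) ^ 2 -
          1 / (Real.Gamma α * Real.Gamma (1 - α)) ^ 2) := by ring
    _ = Real.pi * (Real.pi / Real.cos (Real.pi * (2*α))) *
        ((Real.cos (Real.pi * α) ^ 2 - Real.sin (Real.pi * α) ^ 2) / Real.pi ^ 2) := by
      rw [half_sq, Real.Gamma_half_sub_mul_Gamma_half_add, Real.Gamma_half_sub_mul_Gamma_half_add,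
        Real.Gamma_mul_Gamma_one_sub, div_pow, div_pow, one_div_div, one_div_div, ← sub_div]
    _ = 1 := by
      rw [← cos_double]
      generalize Real.cos (Real.pi * (2*α)) = c at hcos
      field_simp
end

section
/- Let N ≥ 3 be an integer, let φ ∈ ℝ, and set θ = π/(2N). Then: (1) the quadratic equation (1 − cot²θ)·r² + 2·csc²θ·cos(φ)·r + (1 − cot²θ) = 0 has a real solution r if and only if cos(2φ) ≥ cos(2π/N); and (2) if φ = π/N, then r = 1 is the unique real solution. (Note 1 − cot²θ ≠ 0 since 0 < θ < π/4.) -/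
/-- Clearing the denominator `sin² θ` turns the wall equation into
`cos (2θ) r² - 2 cos φ r + cos (2θ) = 0`. -/
theorem wall_equation_iff {θ : ℝ} (hθ : Real.sin θ ≠ 0) (φ r : ℝ) :
    (1 - (Real.cos θ / Real.sin θ)^2) * r^2 + 2 * (1 / Real.sin θ)^2 * Real.cos φ * r +
        (1 - (Real.cos θ / Real.sin θ)^2) = 0 ↔
      Real.cos (2 * θ) * r^2 - 2 * Real.cos φ * r + Real.cos (2 * θ) = 0 := by
  have key : (1 - (Real.cos θ / Real.sin θ)^2) * r^2 + 2 * (1 / Real.sin θ)^2 * Real.cos φ * r +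
        (1 - (Real.cos θ / Real.sin θ)^2) =
      -(Real.cos (2 * θ) * r^2 - 2 * Real.cos φ * r + Real.cos (2 * θ)) / Real.sin θ ^ 2 := by
    rw [Real.cos_two_mul']
    field_simp
    ring
  rw [key, div_eq_zero_iff, or_iff_left (pow_ne_zero 2 hθ), neg_eq_zero]

/-- A palindromic real quadratic `a r² - 2 b r + a` with `a ≠ 0` has a real root iff `a² ≤ b²`. -/
theorem exists_palindromic_quadratic_root_iff {a : ℝ} (ha : a ≠ 0) (b : ℝ) :
    (∃ r : ℝ, a * r^2 - 2 * b * r + a = 0) ↔ a^2 ≤ b^2 := by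
  constructor
  · rintro ⟨r, hr⟩
    have h : b^2 - a^2 = (a * r - b)^2 := by linear_combination (-a) * hr
    nlinarith [sq_nonneg (a * r - b)]
  · intro h
    refine ⟨(b + √(b^2 - a^2)) / a, ?_⟩
    have hs := Real.sq_sqrt (sub_nonneg.mpr h)
    field_simp
    linear_combination hs


/-- Tangency analysis of walls of marginal stability with the `K = 0` contour: with
`θ = π/(2N)`, the quadratic `(1−cot²θ)r² + 2csc²θ·cosφ·r + (1−cot²θ) = 0` has a real
solution iff `cos(2φ) ≥ cos(2π/N)`; and for `φ = π/N`, `r = 1` is its unique real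
solution. -/
theorem wall_tangency_quadratic (N : ℕ) (hN : 3 ≤ N) (φ : ℝ) :
    ((∃ r : ℝ,
        (1 - (Real.cos (Real.pi / (2*N)) / Real.sin (Real.pi / (2*N)))^2) * r^2 +
          2 * (1 / Real.sin (Real.pi / (2*N)))^2 * Real.cos φ * r +
          (1 - (Real.cos (Real.pi / (2*N)) / Real.sin (Real.pi / (2*N)))^2) = 0) ↔
      Real.cos (2*Real.pi/N) ≤ Real.cos (2*φ)) ∧
    (φ = Real.pi / N → ∀ r : ℝ,
      ((1 - (Real.cos (Real.pi / (2*N)) / Real.sin (Real.pi / (2*N)))^2) * r^2 +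
          2 * (1 / Real.sin (Real.pi / (2*N)))^2 * Real.cos φ * r +
          (1 - (Real.cos (Real.pi / (2*N)) / Real.sin (Real.pi / (2*N)))^2) = 0 ↔
        r = 1)) := by
  have hN' : (3 : ℝ) ≤ N := by exact_mod_cast hN
  have hN0 : (0 : ℝ) < N := by linarith
  have hsin : Real.sin (Real.pi / (2*N)) ≠ 0 := by
    refine (Real.sin_pos_of_pos_of_lt_pi (by positivity) ?_).ne'
    exact div_lt_self Real.pi_pos (by linarith)
  have hdouble : 2 * (Real.pi / (2*N)) = Real.pi / N := by field_simp
  have hcos : 0 < Real.cos (Real.pi / N) := by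
    refine Real.cos_pos_of_mem_Ioo ⟨?_, ?_⟩
    · have : 0 < Real.pi / N := by positivity
      linarith [Real.pi_pos]
    · exact div_lt_div_of_pos_left Real.pi_pos two_pos (by linarith)
  simp only [wall_equation_iff hsin, hdouble]
  refine ⟨?_, ?_⟩
  · rw [exists_palindromic_quadratic_root_iff hcos.ne', mul_div_assoc, Real.cos_two_mul,
      Real.cos_two_mul]
    constructor <;> intro h <;> linarith
  · rintro rfl r
    have hfactor : Real.cos (Real.pi / N) * r^2 - 2 * Real.cos (Real.pi / N) * r +
        Real.cos (Real.pi / N) = Real.cos (Real.pi / N) * (r - 1)^2 := by ring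
    rw [hfactor, mul_eq_zero, or_iff_right hcos.ne', sq_eq_zero_iff, sub_eq_zero]
end
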